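/- arXiv:1410.6395 — 2 statements merged into one kernel-verified Lean document; each statement's English description precedes it below -/
import Mathlib

section
/- Let (𝒜, W_𝒜) be a pair consisting of a bicategory and a class of morphisms satisfying conditions (BF), let ℬ be a bicategory, and let F: 𝒜 → ℬ be a pseudofunctor sending every morphism of W_𝒜 to an internal equivalence of ℬ. Then the following two conditions on F are equivalent. (i) (condition (A3) with respect to (W_𝒜, W_{ℬ,min})): for every pair of objects B_𝒜 of 𝒜 and A_ℬ of ℬ and every morphism f: A_ℬ → F₀(B_𝒜), there exist an object A_𝒜, a morphism f_𝒜: A_𝒜 → B_𝒜, an object A'_ℬ, morphisms v¹: A'_ℬ → A_ℬ in W_{ℬ,min} and v²: A'_ℬ → F₀(A_𝒜) in the right saturation (W_{ℬ,min})_sat, and an invertible 2-morphism α: f ∘ v¹ ⇒ F₁(f_𝒜) ∘ v². (ii) (condition (B3)): for every pair of objects B_𝒜 of 𝒜 and A_ℬ of ℬ and every morphism f: A_ℬ → F₀(B_𝒜), there exist an object A_𝒜, a morphism f_𝒜: A_𝒜 → B_𝒜, an internal equivalence e: A_ℬ → F₀(A_𝒜) and an invertible 2-morphism α: f ⇒ F₁(f_𝒜)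 ∘ e. -/
open CategoryTheory Bicategory

/-- A class of 1-morphisms in a bicategory. -/
abbrev MorphClass (C : Type*) [Bicategory C] :=
  ∀ ⦃a b : C⦄, (a ⟶ b) → Prop

/-- An internal equivalence in a bicategory: a morphism `e : a ⟶ b` admitting a
morphism `e' : b ⟶ a` and invertible 2-morphisms `id_a ⇒ e' ∘ e` and `e ∘ e' ⇒ id_b`. -/
def IsInternalEquiv {C : Type*} [Bicategory C] {a b : C} (e : a ⟶ b) : Prop :=
  ∃ e' : b ⟶ a, Nonempty (𝟙 a ≅ e ≫ e') ∧ Nonempty (e' ≫ e ≅ 𝟙 b)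

/-- The class of quasi-units of a bicategory: morphisms `f : a ⟶ a` admitting an
invertible 2-morphism `f ⇒ id_a`. -/
def QuasiUnits (C : Type*) [Bicategory C] : MorphClass C :=
  fun a b f => ∃ h : b = a, Nonempty (cast (congrArg (fun x => a ⟶ x) h) f ≅ 𝟙 a)

/-- The right saturation of a class of morphisms `W`: all `f : b ⟶ a` such that
there are `g : c ⟶ b` and `h : d ⟶ c` with both `f ∘ g` and `g ∘ h` in `W`. -/
def RightSat {C : Type*} [Bicategory C] (W : MorphClass C) : MorphClass C :=
  fun b a f => ∃ (c d : C) (g : c ⟶ b) (h : d ⟶ c), W (g ≫ f) ∧ W (h ≫ g)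

/-- Conditions (BF) for a pair consisting of a bicategory and a class of morphisms. -/
structure SatisfiesBF (C : Type*) [Bicategory C] (W : MorphClass C) : Prop where
  /-- (BF1): identities belong to `W`. -/
  bf1 : ∀ c : C, W (𝟙 c)
  /-- (BF2): `W` is closed under composition. -/
  bf2 : ∀ ⦃a b c : C⦄ (f : a ⟶ b) (g : b ⟶ c), W f → W g → W (f ≫ g)
  /-- (BF3) -/
  bf3 : ∀ ⦃a b c : C⦄ (w : a ⟶ b) (f : c ⟶ b), W w →
    ∃ (d : C) (v : d ⟶ c) (g : d ⟶ a), W v ∧ Nonempty (v ≫ f ≅ g ≫ w)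
  /-- (BF4) -/
  bf4 : ∀ ⦃a b c : C⦄ (w : b ⟶ a) (f₁ f₂ : c ⟶ b), W w →
    ∀ α : f₁ ≫ w ⟶ f₂ ≫ w,
    (∃ (d : C) (v : d ⟶ c) (β : v ≫ f₁ ⟶ v ≫ f₂), W v ∧
      v ◁ α = (α_ v f₁ w).inv ≫ β ▷ w ≫ (α_ v f₂ w).hom ∧
      (IsIso α → IsIso β)) ∧
    (∀ (d d' : C) (v : d ⟶ c) (v' : d' ⟶ c)
      (β : v ≫ f₁ ⟶ v ≫ f₂) (β' : v' ≫ f₁ ⟶ v' ≫ f₂),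
      W v → W v' →
      v ◁ α = (α_ v f₁ w).inv ≫ β ▷ w ≫ (α_ v f₂ w).hom →
      v' ◁ α = (α_ v' f₁ w).inv ≫ β' ▷ w ≫ (α_ v' f₂ w).hom →
      ∃ (e : C) (u : e ⟶ d) (u' : e ⟶ d'), W (u ≫ v) ∧
        ∃ ζ : u ≫ v ≅ u' ≫ v',
          (α_ u v f₁).inv ≫ ζ.hom ▷ f₁ ≫ (α_ u' v' f₁).hom ≫ u' ◁ β' =
            u ◁ β ≫ (α_ u v f₂).inv ≫ ζ.hom ▷ f₂ ≫ (α_ u' v' f₂).hom)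
  /-- (BF5): `W` is closed under invertible 2-morphisms. -/
  bf5 : ∀ ⦃a b : C⦄ (v w : a ⟶ b), W v → Nonempty (v ≅ w) → W w

section QuasiUnits

variable {C : Type*} [Bicategory C]

theorem quasiUnits_iff {a : C} (f : a ⟶ a) : QuasiUnits C f ↔ Nonempty (f ≅ 𝟙 a) :=
  ⟨fun ⟨_, h⟩ => h, fun h => ⟨rfl, h⟩⟩

/-- The right saturation of the class of quasi-units is the class of internal equivalences. -/
theorem rightSat_quasiUnits_iff {a b : C} (f : a ⟶ b) :
    RightSat (QuasiUnits C) f ↔ IsInternalEquiv f := by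
  constructor
  · rintro ⟨c, d, g, h, ⟨rfl, ⟨i⟩⟩, ⟨rfl, ⟨j⟩⟩⟩
    change g ≫ f ≅ 𝟙 _ at i
    change h ≫ g ≅ 𝟙 _ at j
    let k : h ≅ f :=
      (ρ_ h).symm ≪≫ whiskerLeftIso h i.symm ≪≫ (α_ h g f).symm ≪≫ whiskerRightIso j f ≪≫ λ_ f
    exact ⟨g, ⟨j.symm ≪≫ whiskerRightIso k g⟩, ⟨i⟩⟩
  · rintro ⟨g, ⟨i⟩, hj⟩
    exact ⟨b, a, g, f, (quasiUnits_iff _).2 hj, (quasiUnits_iff _).2 ⟨i.symm⟩⟩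

end QuasiUnits

/-- Condition (A3) with respect to `(W_𝒜, W_{ℬ,min})` is equivalent to
condition (B3). -/
theorem statement2 {A : Type*} {B : Type*} [Bicategory A] [Bicategory B]
    (WA : MorphClass A) (hWA : SatisfiesBF A WA)
    (F : Pseudofunctor A B)
    (hF : ∀ ⦃a b : A⦄ (w : a ⟶ b), WA w → IsInternalEquiv (F.map w)) :
    (∀ (Ba : A) (Ab : B) (f : Ab ⟶ F.obj Ba),
        ∃ (Aa : A) (fa : Aa ⟶ Ba) (A'b : B) (v₁ : A'b ⟶ Ab) (v₂ : A'b ⟶ F.obj Aa),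
          QuasiUnits B v₁ ∧ RightSat (QuasiUnits B) v₂ ∧
          Nonempty (v₁ ≫ f ≅ v₂ ≫ F.map fa))
    ↔ (∀ (Ba : A) (Ab : B) (f : Ab ⟶ F.obj Ba),
        ∃ (Aa : A) (fa : Aa ⟶ Ba) (e : Ab ⟶ F.obj Aa),
          IsInternalEquiv e ∧ Nonempty (f ≅ e ≫ F.map fa)) := by
  constructor
  · intro H Ba Ab f
    obtain ⟨Aa, fa, A'b, v₁, v₂, ⟨rfl, ⟨i⟩⟩, hv₂, ⟨α⟩⟩ := H Ba Ab f
    change v₁ ≅ 𝟙 _ at i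
    exact ⟨Aa, fa, v₂, (rightSat_quasiUnits_iff v₂).1 hv₂,
      ⟨(λ_ f).symm ≪≫ whiskerRightIso i.symm f ≪≫ α⟩⟩
  · intro H Ba Ab f
    obtain ⟨Aa, fa, e, he, ⟨α⟩⟩ := H Ba Ab f
    exact ⟨Aa, fa, Ab, 𝟙 Ab, e, (quasiUnits_iff _).2 ⟨Iso.refl _⟩,
      (rightSat_quasiUnits_iff e).2 he, ⟨λ_ f ≪≫ α⟩⟩
end

section
/- Let (𝒜, W_𝒜) be a pair consisting of a bicategory and a class of morphisms satisfying conditions (BF), let ℬ be a bicategory, and let F: 𝒜 → ℬ be a pseudofunctor that sends every morphism of W_𝒜 to an internal equivalence of ℬ and satisfies conditions (EF2) and (EF3). Then every morphism w of 𝒜 such that F₁(w) is an internal equivalence in ℬ belongs to the right saturation (W_𝒜)_sat. -/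
open CategoryTheory Bicategory

namespace IsInternalEquiv

variable {C : Type*} [Bicategory C]

theorem comp {a b c : C} {e : a ⟶ b} {f : b ⟶ c} (he : IsInternalEquiv e)
    (hf : IsInternalEquiv f) : IsInternalEquiv (e ≫ f) := by
  obtain ⟨e', ⟨η⟩, ⟨κ⟩⟩ := he
  obtain ⟨f', ⟨η'⟩, ⟨κ'⟩⟩ := hf
  refine ⟨f' ≫ e', ⟨?_⟩, ⟨?_⟩⟩
  · exact η ≪≫ whiskerLeftIso e ((λ_ e').symm ≪≫ whiskerRightIso η' e' ≪≫ α_ f f' e') ≪≫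
      (α_ e f (f' ≫ e')).symm
  · exact α_ f' e' (e ≫ f) ≪≫ whiskerLeftIso f' ((α_ e' e f).symm ≪≫
      whiskerRightIso κ f ≪≫ λ_ f) ≪≫ κ'

theorem of_iso {a b : C} {e f : a ⟶ b} (i : e ≅ f) (he : IsInternalEquiv e) :
    IsInternalEquiv f := by
  obtain ⟨e', ⟨η⟩, ⟨κ⟩⟩ := he
  exact ⟨e', ⟨η ≪≫ whiskerRightIso i e'⟩, ⟨whiskerLeftIso e' i.symm ≪≫ κ⟩⟩

end IsInternalEquiv

/-- A pseudofunctor that is bijective on 2-morphisms reflects isomorphism of 1-morphisms. -/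
theorem nonempty_iso_of_map_iso {A : Type*} {B : Type*} [Bicategory A] [Bicategory B]
    (F : Pseudofunctor A B)
    (hEF3 : ∀ ⦃a b : A⦄ (f₁ f₂ : a ⟶ b) (α : F.map f₁ ⟶ F.map f₂),
      ∃! αa : f₁ ⟶ f₂, F.map₂ αa = α)
    {a b : A} {f g : a ⟶ b} (i : F.map f ≅ F.map g) : Nonempty (f ≅ g) := by
  obtain ⟨α, hα, -⟩ := hEF3 f g i.hom
  obtain ⟨β, hβ, -⟩ := hEF3 g f i.inv
  exact ⟨⟨α, β, (hEF3 f f (𝟙 _)).unique (by simp [hα, hβ]) (by simp),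
    (hEF3 g g (𝟙 _)).unique (by simp [hα, hβ]) (by simp)⟩⟩

/-- A morphism that `F` sends to an internal equivalence can be precomposed with another such
morphism so that the composite lies in `W`. -/
theorem exists_comp_mem_of_map_isInternalEquiv {A : Type*} {B : Type*}
    [Bicategory A] [Bicategory B] (W : MorphClass A)
    (hBF5 : ∀ ⦃a b : A⦄ (v w : a ⟶ b), W v → Nonempty (v ≅ w) → W w)
    (F : Pseudofunctor A B)
    (hF : ∀ ⦃a b : A⦄ (w : a ⟶ b), W w → IsInternalEquiv (F.map w))
    (hEF2 : ∀ (a b : A) (f : F.obj a ⟶ F.obj b),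
      ∃ (a' : A) (fa : a' ⟶ b) (w : a' ⟶ a), W w ∧ Nonempty (F.map fa ≅ F.map w ≫ f))
    (hEF3 : ∀ ⦃a b : A⦄ (f₁ f₂ : a ⟶ b) (α : F.map f₁ ⟶ F.map f₂),
      ∃! αa : f₁ ⟶ f₂, F.map₂ αa = α)
    {a b : A} (w : a ⟶ b) (hw : IsInternalEquiv (F.map w)) :
    ∃ (c : A) (g : c ⟶ a), W (g ≫ w) ∧ IsInternalEquiv (F.map g) := by
  obtain ⟨e, ⟨η⟩, ⟨κ⟩⟩ := hw
  obtain ⟨c, g, v, hv, ⟨i⟩⟩ := hEF2 b a e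
  have he : IsInternalEquiv e := ⟨F.map w, ⟨κ.symm⟩, ⟨η.symm⟩⟩
  refine ⟨c, g, hBF5 v _ hv (nonempty_iso_of_map_iso F hEF3 ?_), ((hF v hv).comp he).of_iso i.symm⟩
  exact (F.mapComp g w ≪≫ whiskerRightIso i (F.map w) ≪≫ α_ (F.map v) e (F.map w) ≪≫
    whiskerLeftIso (F.map v) κ ≪≫ ρ_ (F.map v)).symm

/-- if `F` sends `W_𝒜` to internal equivalences and satisfies (EF2), (EF3),
then every morphism `w` of `𝒜` with `F₁(w)` an internal equivalence belongs to the right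
saturation of `W_𝒜`. -/
theorem statement8 {A : Type*} {B : Type*} [Bicategory A] [Bicategory B]
    (WA : MorphClass A) (hWA : SatisfiesBF A WA)
    (F : Pseudofunctor A B)
    (hF : ∀ ⦃a b : A⦄ (w : a ⟶ b), WA w → IsInternalEquiv (F.map w))
    (hEF2 : ∀ (Aa Ba : A) (f : F.obj Aa ⟶ F.obj Ba),
      ∃ (A'a : A) (fa : A'a ⟶ Ba) (w : A'a ⟶ Aa),
        WA w ∧ Nonempty (F.map fa ≅ F.map w ≫ f))
    (hEF3 : ∀ ⦃Aa Ba : A⦄ (f₁ f₂ : Aa ⟶ Ba) (α : F.map f₁ ⟶ F.map f₂),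
      ∃! αa : f₁ ⟶ f₂, F.map₂ αa = α) :
    ∀ ⦃a b : A⦄ (w : a ⟶ b), IsInternalEquiv (F.map w) → RightSat WA w := by
  intro a b w hw
  obtain ⟨c, g, hgw, hg⟩ :=
    exists_comp_mem_of_map_isInternalEquiv WA hWA.bf5 F hF hEF2 hEF3 w hw
  obtain ⟨d, h, hhg, -⟩ :=
    exists_comp_mem_of_map_isInternalEquiv WA hWA.bf5 F hF hEF2 hEF3 g hg
  exact ⟨c, d, g, h, hgw, hhg⟩
end
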